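/- arXiv:2406.09344 — 2 statements merged into one kernel-verified Lean document; each statement's English description precedes it below -/
import Mathlib

section
/- Let s ∈ (0,1), n ∈ ℕ, and p_k = -1 + e^{-k} for a positive integer k. There is a constant C = C(s,n), independent of k and z, such that for all z in the open unit disc, |exp(-(z+1)^{-s})| / (|p_k|^n |z - 1/p_k|^n) ≤ C · exp(-(1/2) cos(sπ/2) |z+1|^{-s}). -/
open Complex Real

lemma re_add_one_pos_of_norm_lt_one {z : ℂ} (hz : ‖z‖ < 1) : 0 < z.re + 1 := by
  have := (abs_lt.1 ((Complex.abs_re_le_norm z).trans_lt hz)).1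
  linarith

/-- In the right half-plane, `exp (-w ^ (-s))` decays at least like the exponential of
`-cos (s π / 2) |w| ^ (-s)`. -/
lemma norm_exp_neg_cpow_neg_le {s : ℝ} (hs : s ∈ Set.Ioo (0 : ℝ) 1) {w : ℂ} (hw : 0 < w.re) :
    ‖Complex.exp (-(w ^ (-(s : ℂ))))‖ ≤
      Real.exp (-(Real.cos (s * π / 2) * ‖w‖ ^ (-s))) := by
  obtain ⟨hs0, hs1⟩ := hs
  have hw0 : w ≠ 0 := by
    rintro rfl
    simp at hw
  have harg : |w.arg| ≤ π / 2 := Complex.abs_arg_le_pi_div_two_iff.2 hw.le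
  have hre : (w ^ (-(s : ℂ))).re = ‖w‖ ^ (-s) * Real.cos (w.arg * -s) := by
    have := Complex.cpow_ofReal_re w (-s)
    simpa using this
  have hcos : Real.cos (s * π / 2) ≤ Real.cos (w.arg * -s) := by
    rw [← Real.cos_abs (w.arg * -s)]
    have habs : |w.arg * -s| = |w.arg| * s := by
      rw [abs_mul, abs_neg, abs_of_pos hs0]
    rw [habs]
    apply Real.cos_le_cos_of_nonneg_of_le_pi
    · positivity
    · nlinarith [Real.pi_pos]
    · nlinarith
  rw [Complex.norm_exp, Complex.neg_re, hre]
  refine Real.exp_le_exp.2 (neg_le_neg ?_)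
  rw [mul_comm]
  gcongr

/-- The distance from a point of the unit disc to a pole `1 / p` with `-1 < p ≤ -1/2`, weighted
by `|p|`, is comparable to the distance to `-1`. -/
lemma norm_add_one_div_two_le_abs_mul_norm_sub {p : ℝ} (hp1 : -1 < p) (hp2 : p ≤ -(1 / 2))
    {z : ℂ} (hz : ‖z‖ < 1) :
    ‖z + 1‖ / 2 ≤ |p| * ‖z - 1 / (p : ℂ)‖ := by
  have hre := re_add_one_pos_of_norm_lt_one hz
  have hinv : 1 / p ≤ -1 := by
    rw [div_le_iff_of_neg (by linarith)]
    linarith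
  have hdist : ‖z + 1‖ ≤ ‖z - 1 / (p : ℂ)‖ := by
    rw [show z - 1 / (p : ℂ) = z - ((1 / p : ℝ) : ℂ) by push_cast; rfl]
    rw [Complex.norm_eq_sqrt_sq_add_sq, Complex.norm_eq_sqrt_sq_add_sq]
    apply Real.sqrt_le_sqrt
    simp only [Complex.add_re, Complex.add_im, Complex.sub_re, Complex.sub_im, Complex.one_re,
      Complex.one_im, Complex.ofReal_re, Complex.ofReal_im, add_zero, sub_zero]
    nlinarith
  have habs : 1 / 2 ≤ |p| := by
    rw [abs_of_neg (by linarith)]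
    linarith
  nlinarith [norm_nonneg (z + 1)]

/-- On `(0, 2)` the function `exp (-a r ^ (-s))` beats any power of `r`. -/
lemma exists_exp_neg_mul_rpow_le_pow {s a : ℝ} (hs : 0 < s) (ha : 0 < a) (n : ℕ) :
    ∃ C : ℝ, 0 < C ∧ ∀ r : ℝ, 0 < r → r < 2 →
      Real.exp (-(a * r ^ (-s))) ≤ C * r ^ n := by
  obtain ⟨m, hm⟩ := exists_nat_ge ((n : ℝ) / s)
  have hmn : 0 ≤ s * m - n := by
    rw [div_le_iff₀ hs] at hm
    linarith
  refine ⟨m.factorial / a ^ m * 2 ^ (s * m - n), by positivity, fun r hr hr2 => ?_⟩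
  have hexp := Real.pow_div_factorial_le_exp (a * r ^ (-s)) (by positivity) m
  have hpow : (r ^ (-s)) ^ m = (r ^ (s * m))⁻¹ := by
    rw [← Real.rpow_natCast, ← Real.rpow_mul hr.le, ← Real.rpow_neg hr.le, neg_mul]
  have hsplit : r ^ (s * m) = r ^ (s * m - n) * r ^ n := by
    rw [← Real.rpow_natCast r n, ← Real.rpow_add hr]
    ring_nf
  have hle : r ^ (s * m - n) ≤ (2 : ℝ) ^ (s * m - n) := Real.rpow_le_rpow hr.le hr2.le hmn
  calc Real.exp (-(a * r ^ (-s))) = (Real.exp (a * r ^ (-s)))⁻¹ := Real.exp_neg _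
    _ ≤ ((a * r ^ (-s)) ^ m / m.factorial)⁻¹ := by gcongr
    _ = m.factorial / a ^ m * r ^ (s * m) := by
      rw [mul_pow, hpow]
      field_simp
    _ ≤ m.factorial / a ^ m * 2 ^ (s * m - n) * r ^ n := by
      rw [hsplit, ← mul_assoc]
      gcongr

/-- There is a constant `C = C(s,n)`, independent of `k` and `z`, such that for all
`z` in the open unit disc,
`|exp(-(z+1)^{-s})| / (|p_k|^n |z - 1/p_k|^n) ≤ C exp(-(1/2)cos(sπ/2)|z+1|^{-s})`,
where `p_k = -1 + e^{-k}`. -/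
theorem exp_neg_cpow_div_pole_bound (s : ℝ) (hs : s ∈ Set.Ioo (0 : ℝ) 1) (n : ℕ) :
    ∃ C : ℝ, 0 < C ∧ ∀ k : ℕ, 0 < k → ∀ z : ℂ, ‖z‖ < 1 →
      ‖Complex.exp (-((z + 1) ^ (-(s : ℂ))))‖ /
          (|(-1 + Real.exp (-(k : ℝ)))| ^ n *
            ‖z - 1 / ((-1 + Real.exp (-(k : ℝ)) : ℝ) : ℂ)‖ ^ n)
        ≤ C * Real.exp (-(1 / 2) * Real.cos (s * π / 2) * ‖z + 1‖ ^ (-s)) := by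
  have hc : 0 < Real.cos (s * π / 2) := by
    obtain ⟨hs0, hs1⟩ := hs
    apply Real.cos_pos_of_mem_Ioo
    constructor <;> nlinarith [Real.pi_pos]
  obtain ⟨C, hC, hbound⟩ := exists_exp_neg_mul_rpow_le_pow hs.1 (half_pos hc) n
  refine ⟨C * 2 ^ n, by positivity, fun k hk z hz => ?_⟩
  have hre : 0 < (z + 1).re := by simpa using re_add_one_pos_of_norm_lt_one hz
  have hr : 0 < ‖z + 1‖ := hre.trans_le (Complex.re_le_norm _)
  have hr2 : ‖z + 1‖ < 2 := by
    have := norm_add_le z 1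
    rw [norm_one] at this
    linarith
  have hek : Real.exp (-(k : ℝ)) ≤ 1 / 2 := by
    have hk1 : (1 : ℝ) ≤ k := by exact_mod_cast hk
    have := Real.add_one_le_exp (k : ℝ)
    rw [Real.exp_neg, one_div]
    exact inv_anti₀ two_pos (by linarith)
  have hpole := norm_add_one_div_two_le_abs_mul_norm_sub
    (p := -1 + Real.exp (-(k : ℝ))) (by linarith [Real.exp_pos (-(k : ℝ))]) (by linarith) hz
  have hnum := norm_exp_neg_cpow_neg_le hs hre
  rw [← mul_pow]
  calc _ ≤ Real.exp (-(Real.cos (s * π / 2) * ‖z + 1‖ ^ (-s))) / (‖z + 1‖ / 2) ^ n := by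
        gcongr
    _ = Real.exp (-(Real.cos (s * π / 2) / 2 * ‖z + 1‖ ^ (-s))) *
          Real.exp (-(1 / 2) * Real.cos (s * π / 2) * ‖z + 1‖ ^ (-s)) / (‖z + 1‖ / 2) ^ n := by
        rw [← Real.exp_add]
        ring_nf
    _ ≤ C * ‖z + 1‖ ^ n *
          Real.exp (-(1 / 2) * Real.cos (s * π / 2) * ‖z + 1‖ ^ (-s)) / (‖z + 1‖ / 2) ^ n := by
        gcongr
        exact hbound _ hr hr2
    _ = _ := by
        rw [div_pow]
        field_simp
end

section
/- Let ψ ∈ H^{1/2}(∂D², S¹) and let φ be its harmonic extension to the open unit disc D². Then |φ(z)| → 1 uniformly as |z| → 1; that is, for every ε > 0 there is r₀ < 1 such that dist(φ(z), S¹) < ε whenever r₀ < |z| < 1. -/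
open Complex Real MeasureTheory

/-- The (normalized) Poisson kernel `P_r(t) = (1-r²)/(2π|re^{it}-1|²)`. -/
noncomputable def poissonKer (r t : ℝ) : ℝ :=
  (1 - r ^ 2) / (2 * π * ‖(r : ℂ) * Complex.exp (Complex.I * t) - 1‖ ^ 2)

lemma norm_mul_exp_sub_one_eq (r α θ : ℝ) :
    ‖(r : ℂ) * Complex.exp (Complex.I * ((α - θ : ℝ) : ℂ)) - 1‖ =
      ‖(r : ℂ) * Complex.exp (Complex.I * α) - Complex.exp (Complex.I * θ)‖ := by
  have h : (r : ℂ) * Complex.exp (Complex.I * α) - Complex.exp (Complex.I * θ) =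
      ((r : ℂ) * Complex.exp (Complex.I * ((α - θ : ℝ) : ℂ)) - 1) *
        Complex.exp (Complex.I * θ) := by
    rw [sub_mul, mul_assoc, ← Complex.exp_add, one_mul]
    push_cast
    ring_nf
  rw [h, norm_mul, Complex.norm_exp_I_mul_ofReal, mul_one]

lemma one_sub_le_norm_mul_exp_sub_one {r : ℝ} (hr : 0 ≤ r) (t : ℝ) :
    1 - r ≤ ‖(r : ℂ) * Complex.exp (Complex.I * t) - 1‖ := by
  have h := norm_sub_norm_le (1 : ℂ) ((r : ℂ) * Complex.exp (Complex.I * t))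
  rw [norm_mul, Complex.norm_exp_I_mul_ofReal, norm_one, norm_sub_rev, Complex.norm_real,
    Real.norm_of_nonneg hr, mul_one] at h
  exact h

lemma poissonKer_nonneg {r : ℝ} (hr : 0 ≤ r) (hr1 : r < 1) (t : ℝ) : 0 ≤ poissonKer r t :=
  div_nonneg (by nlinarith) (by positivity)

lemma poissonKer_sub_eq_poissonKernel (r α θ : ℝ) :
    poissonKer r (α - θ) =
      (2 * π)⁻¹ * poissonKernel 0 (circleMap 0 r θ) (circleMap 0 1 α) := by
  have h : ‖(r : ℂ) * Complex.exp (Complex.I * ((α - θ : ℝ) : ℂ)) - 1‖ =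
      ‖circleMap 0 1 α - circleMap 0 r θ‖ := by
    rw [← Complex.norm_conj]
    have : circleMap 0 1 α - circleMap 0 r θ = -((starRingEnd ℂ)
        ((r : ℂ) * Complex.exp (Complex.I * ((α - θ : ℝ) : ℂ)) - 1) *
          Complex.exp (Complex.I * α)) := by
      simp only [circleMap, map_sub, map_mul, Complex.conj_ofReal, map_one, ← Complex.exp_conj,
        Complex.conj_I, sub_mul, mul_assoc, ← Complex.exp_add]
      push_cast
      ring_nf
    rw [this, norm_neg, norm_mul, Complex.norm_exp_I_mul_ofReal, mul_one]
  rw [poissonKer, poissonKernel_def, h]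
  simp only [sub_zero, norm_circleMap_zero, sq_abs, one_pow]
  rw [mul_comm (2 * π), ← div_div, div_eq_inv_mul _ (2 * π)]

/-- The Poisson kernel has total mass one over a period. -/
lemma integral_poissonKer_sub {r : ℝ} (hr : 0 ≤ r) (hr1 : r < 1) (θ : ℝ) :
    ∫ α in Set.Ioc 0 (2 * π), poissonKer r (α - θ) = 1 := by
  have hw : circleMap 0 r θ ∈ Metric.ball (0 : ℂ) 1 := by
    simp [abs_of_nonneg hr, hr1]
  have h := (diffContOnCl_const (𝕜 := ℂ) (c := (1 : ℂ))).circleAverage_poissonKernel_smul hw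
  rw [Real.circleAverage_def, intervalIntegral.integral_of_le (by positivity)] at h
  simp only [Pi.smul_apply', Complex.real_smul, mul_one] at h
  simp_rw [poissonKer_sub_eq_poissonKernel, integral_const_mul]
  exact_mod_cast h

/-- The product of two Poisson kernels absorbs the Gagliardo weight. -/
lemma poissonKer_mul_poissonKer_le {r : ℝ} (hr : 1 / 2 ≤ r) (hr1 : r < 1) (θ α σ : ℝ) :
    poissonKer r (α - θ) * poissonKer r (σ - θ) *
        ‖Complex.exp (Complex.I * α) - Complex.exp (Complex.I * σ)‖ ^ 2 ≤
      3 * (1 - r) * (poissonKer r (α - θ) + poissonKer r (σ - θ)) := by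
  have ha := one_sub_le_norm_mul_exp_sub_one (by linarith : 0 ≤ r) (α - θ)
  have hb := one_sub_le_norm_mul_exp_sub_one (by linarith : 0 ≤ r) (σ - θ)
  have htri : r * ‖Complex.exp (Complex.I * α) - Complex.exp (Complex.I * σ)‖ ≤
      ‖(r : ℂ) * Complex.exp (Complex.I * ((α - θ : ℝ) : ℂ)) - 1‖ +
      ‖(r : ℂ) * Complex.exp (Complex.I * ((σ - θ : ℝ) : ℂ)) - 1‖ := by
    rw [norm_mul_exp_sub_one_eq, norm_mul_exp_sub_one_eq]
    refine le_trans (le_of_eq ?_) (norm_sub_le _ _)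
    rw [sub_sub_sub_cancel_right, ← mul_sub, norm_mul, Complex.norm_real,
      Real.norm_of_nonneg (by linarith)]
  unfold poissonKer
  set a := ‖(r : ℂ) * Complex.exp (Complex.I * ((α - θ : ℝ) : ℂ)) - 1‖
  set b := ‖(r : ℂ) * Complex.exp (Complex.I * ((σ - θ : ℝ) : ℂ)) - 1‖
  set d := ‖Complex.exp (Complex.I * α) - Complex.exp (Complex.I * σ)‖
  have hd : 0 ≤ d := norm_nonneg _
  have ha0 : 0 < a := by linarith
  have hb0 : 0 < b := by linarith
  have hd2 : d ^ 2 ≤ 8 * (a ^ 2 + b ^ 2) := by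
    have h1 : d ≤ 2 * (a + b) := by nlinarith
    nlinarith [sq_nonneg (a - b)]
  have hπ := Real.pi_gt_three
  have e1 : (1 - r ^ 2) / (2 * π * a ^ 2) * ((1 - r ^ 2) / (2 * π * b ^ 2)) * d ^ 2 =
      (1 - r ^ 2) ^ 2 * d ^ 2 / (4 * π ^ 2 * (a ^ 2 * b ^ 2)) := by
    field_simp
    ring
  have e2 : 3 * (1 - r) * ((1 - r ^ 2) / (2 * π * a ^ 2) + (1 - r ^ 2) / (2 * π * b ^ 2)) =
      (6 * π * (1 - r) * (1 - r ^ 2) * (a ^ 2 + b ^ 2)) / (4 * π ^ 2 * (a ^ 2 * b ^ 2)) := by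
    field_simp
    ring
  rw [e1, e2]
  gcongr ?_ / _
  have h0 : 0 ≤ (1 - r) * (1 - r ^ 2) := mul_nonneg (by linarith) (by nlinarith)
  calc (1 - r ^ 2) ^ 2 * d ^ 2 = (1 - r) * (1 - r ^ 2) * ((1 + r) * d ^ 2) := by ring
    _ ≤ (1 - r) * (1 - r ^ 2) * (6 * π * (a ^ 2 + b ^ 2)) := by
        refine mul_le_mul_of_nonneg_left ?_ h0
        nlinarith [sq_nonneg d, mul_pos ha0 ha0, mul_pos hb0 hb0]
    _ = _ := by ring

lemma one_sub_mul_poissonKer_le {r : ℝ} (hr : 0 ≤ r) (hr1 : r < 1) (t : ℝ) :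
    (1 - r) * poissonKer r t ≤ 1 / 3 := by
  have ha := one_sub_le_norm_mul_exp_sub_one hr t
  unfold poissonKer
  set a := ‖(r : ℂ) * Complex.exp (Complex.I * t) - 1‖
  have ha0 : 0 < a := by linarith
  have hπ := Real.pi_gt_three
  rw [mul_div_assoc', div_le_div_iff₀ (by positivity) (by norm_num)]
  have h2 : (1 - r) ^ 2 ≤ a ^ 2 := by gcongr
  nlinarith [sq_nonneg a, sq_nonneg (1 - r)]

/-- Variance identity for a circle-valued map with respect to a density of total mass one. -/
lemma integral_mul_norm_sub_sq {X : Type*} [MeasurableSpace X] {μ : Measure X} [SFinite μ]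
    {p : X → ℝ} {ψ : X → ℂ} (hp : Integrable p μ) (hp1 : ∫ x, p x ∂μ = 1)
    (hψ : AEStronglyMeasurable ψ μ) (hcirc : ∀ x, ‖ψ x‖ = 1) :
    ∫ z, p z.1 * p z.2 * ‖ψ z.1 - ψ z.2‖ ^ 2 ∂(μ.prod μ) = 2 - 2 * ‖∫ x, p x • ψ x ∂μ‖ ^ 2 := by
  have hpψ : Integrable (fun x => p x • ψ x) μ :=
    hp.smul_bdd 1 hψ (Filter.Eventually.of_forall fun x => (hcirc x).le)
  have hconj : Integrable (fun x => (starRingEnd ℂ) (p x • ψ x)) μ :=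
    (Complex.conjLIE.toContinuousLinearEquiv.integrable_comp_iff).2 hpψ
  have hpt : ∀ z : X × X, p z.1 * p z.2 * ‖ψ z.1 - ψ z.2‖ ^ 2 =
      2 * (p z.1 * p z.2) - 2 * ((p z.1 • ψ z.1) * (starRingEnd ℂ) (p z.2 • ψ z.2)).re := by
    intro z
    rw [← Complex.normSq_eq_norm_sq, Complex.normSq_sub, Complex.normSq_eq_norm_sq,
      Complex.normSq_eq_norm_sq, hcirc, hcirc]
    simp only [Complex.real_smul, map_mul, Complex.conj_ofReal]
    have : (p z.1 : ℂ) * ψ z.1 * (p z.2 * (starRingEnd ℂ) (ψ z.2)) =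
        ((p z.1 * p z.2 : ℝ) : ℂ) * (ψ z.1 * (starRingEnd ℂ) (ψ z.2)) := by
      push_cast; ring
    rw [this, Complex.re_ofReal_mul]
    ring
  have hint := hpψ.mul_prod hconj
  simp_rw [hpt]
  have hintre : Integrable
      (fun z : X × X => ((p z.1 • ψ z.1) * (starRingEnd ℂ) (p z.2 • ψ z.2)).re) (μ.prod μ) :=
    hint.re
  rw [integral_sub ((hp.mul_prod hp).const_mul 2) (hintre.const_mul 2), integral_const_mul,
    integral_const_mul, integral_prod_mul, hp1]
  have hre := integral_re hint
  simp only [RCLike.re_to_complex] at hre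
  rw [hre, integral_prod_mul (fun x => p x • ψ x) (fun x => (starRingEnd ℂ) (p x • ψ x)),
    integral_conj, Complex.mul_conj, Complex.ofReal_re, Complex.normSq_eq_norm_sq]
  ring

/-- The part of an integrable function above a high level has small integral. -/
lemma exists_integral_max_sub_lt {X : Type*} [MeasurableSpace X] {μ : Measure X} {G : X → ℝ}
    (hG : Integrable G μ) {ε : ℝ} (hε : 0 < ε) :
    ∃ M : ℕ, ∫ x, max (G x - M) 0 ∂μ < ε := by
  have h : Filter.Tendsto (fun M : ℕ => ∫ x, max (G x - M) 0 ∂μ) Filter.atTop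
      (nhds (∫ _, (0 : ℝ) ∂μ)) := by
    refine tendsto_integral_of_dominated_convergence (fun x => |G x|) (fun M => ?_) hG.abs
      (fun M => ?_) ?_
    · exact (hG.aestronglyMeasurable.sub aestronglyMeasurable_const).sup
        aestronglyMeasurable_const
    · filter_upwards with x
      rw [Real.norm_of_nonneg (le_max_right _ _)]
      refine max_le ?_ (abs_nonneg _)
      have : (0 : ℝ) ≤ M := M.cast_nonneg
      linarith [le_abs_self (G x)]
    · filter_upwards with x
      refine tendsto_const_nhds.congr' ?_
      obtain ⟨N, hN⟩ := exists_nat_ge (G x)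
      filter_upwards [Filter.eventually_ge_atTop N] with M hM
      have : (N : ℝ) ≤ M := by exact_mod_cast hM
      exact (max_eq_right (by linarith)).symm
  rw [integral_zero] at h
  exact (h.eventually_lt_const hε).exists

/-- The numerator of the Gagliardo integrand vanishes wherever its denominator does. -/
lemma norm_sub_sq_eq_mul_gagliardo {ψ : ℝ → ℂ} (hper : ∀ α, ψ (α + 2 * π) = ψ α) (α σ : ℝ) :
    ‖ψ α - ψ σ‖ ^ 2 = ‖Complex.exp (Complex.I * α) - Complex.exp (Complex.I * σ)‖ ^ 2 *
      (‖ψ α - ψ σ‖ ^ 2 / ‖Complex.exp (Complex.I * α) - Complex.exp (Complex.I * σ)‖ ^ 2) := by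
  by_cases h : Complex.exp (Complex.I * α) = Complex.exp (Complex.I * σ)
  · obtain ⟨n, hn⟩ := Complex.exp_eq_exp_iff_exists_int.1 h
    have hα : α = σ + n * (2 * π) := by
      have : (α : ℂ) = ((σ + n * (2 * π) : ℝ) : ℂ) := by
        apply mul_left_cancel₀ Complex.I_ne_zero
        rw [hn]
        push_cast
        ring
      exact_mod_cast this
    have hψ : ψ α = ψ σ := by
      rw [hα]
      exact (Function.Periodic.int_mul (f := ψ) (c := 2 * π) hper n) σ
    simp [hψ]
  · have : ‖Complex.exp (Complex.I * α) - Complex.exp (Complex.I * σ)‖ ≠ 0 :=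
      norm_ne_zero_iff.2 (sub_ne_zero.2 h)
    field_simp

/-- If `ψ ∈ H^{1/2}(∂D², S¹)` (a circle-valued map on the boundary with finite Gagliardo
`H^{1/2}` seminorm) and `φ` is its harmonic (Poisson) extension, then `|φ(z)| → 1`
uniformly as `|z| → 1`. -/
theorem poisson_extension_modulus_to_one (ψ : ℝ → ℂ) (hmeas : Measurable ψ)
    (hper : ∀ α, ψ (α + 2 * π) = ψ α) (hcirc : ∀ α, ‖ψ α‖ = 1)
    (hH12 : IntegrableOn
      (fun p : ℝ × ℝ =>
        ‖ψ p.1 - ψ p.2‖ ^ 2 / ‖Complex.exp (Complex.I * p.1) - Complex.exp (Complex.I * p.2)‖ ^ 2)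
      (Set.Ioc 0 (2 * π) ×ˢ Set.Ioc 0 (2 * π))) :
    ∀ ε > 0, ∃ r₀ : ℝ, 0 ≤ r₀ ∧ r₀ < 1 ∧ ∀ r θ : ℝ, r₀ < r → r < 1 →
      |‖∫ α in (0 : ℝ)..(2 * π), poissonKer r (α - θ) • ψ α‖ - 1| < ε := by
  intro ε hε
  set G : ℝ × ℝ → ℝ := fun p =>
    ‖ψ p.1 - ψ p.2‖ ^ 2 / ‖Complex.exp (Complex.I * p.1) - Complex.exp (Complex.I * p.2)‖ ^ 2
  set μ : Measure ℝ := volume.restrict (Set.Ioc 0 (2 * π)) with hμ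
  have hGint : Integrable G (μ.prod μ) := by
    rw [hμ, Measure.prod_restrict]
    exact hH12
  have hμuniv : μ.real Set.univ = 2 * π := by
    simp [hμ, Real.pi_pos.le]
  obtain ⟨M, hM⟩ := exists_integral_max_sub_lt hGint (half_pos hε)
  have hπ := Real.pi_pos
  have hM0 : (0 : ℝ) ≤ M := M.cast_nonneg
  set η : ℝ := ε / 2 / (6 * π * (M + 1)) with hη
  have hη0 : 0 < η := by positivity
  refine ⟨max (1 / 2) (1 - η), by positivity, max_lt (by norm_num) (by linarith), ?_⟩
  intro r θ hr hr1
  obtain ⟨hr2, hrη⟩ := max_lt_iff.1 hr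
  have hr0 : 0 ≤ r := by linarith
  set p : ℝ → ℝ := fun α => poissonKer r (α - θ)
  have hp0 : ∀ α, 0 ≤ p α := fun α => poissonKer_nonneg hr0 hr1 _
  have hp1 : ∫ α, p α ∂μ = 1 := integral_poissonKer_sub hr0 hr1 θ
  have hpint : Integrable p μ := Integrable.of_integral_ne_zero (by rw [hp1]; exact one_ne_zero)
  have hvar := integral_mul_norm_sub_sq hpint hp1 hmeas.aestronglyMeasurable hcirc
  rw [intervalIntegral.integral_of_le (by positivity)]
  change |‖∫ α, p α • ψ α ∂μ‖ - 1| < ε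
  set A := ‖∫ α, p α • ψ α ∂μ‖
  have hfst : Integrable (fun z : ℝ × ℝ => p z.1) (μ.prod μ) := hpint.comp_fst μ
  have hsnd : Integrable (fun z : ℝ × ℝ => p z.2) (μ.prod μ) := hpint.comp_snd μ
  have hsum : Integrable (fun z : ℝ × ℝ => p z.1 + p z.2) (μ.prod μ) := hfst.add hsnd
  have hmax : Integrable (fun z => max (G z - M) 0) (μ.prod μ) :=
    (hGint.sub (integrable_const _)).pos_part
  have hbound : ∀ z : ℝ × ℝ, p z.1 * p z.2 * ‖ψ z.1 - ψ z.2‖ ^ 2 ≤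
      M * (3 * (1 - r)) * (p z.1 + p z.2) + 2 * max (G z - M) 0 := by
    intro z
    have hK := poissonKer_mul_poissonKer_le hr2.le hr1 θ z.1 z.2
    have h1 := one_sub_mul_poissonKer_le hr0 hr1 (z.1 - θ)
    have h2 := one_sub_mul_poissonKer_le hr0 hr1 (z.2 - θ)
    rw [norm_sub_sq_eq_mul_gagliardo hper, ← mul_assoc]
    change _ * G z ≤ _
    set K := p z.1 * p z.2 *
      ‖Complex.exp (Complex.I * z.1) - Complex.exp (Complex.I * z.2)‖ ^ 2
    change K ≤ 3 * (1 - r) * (p z.1 + p z.2) at hK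
    change (1 - r) * p z.1 ≤ 1 / 3 at h1
    change (1 - r) * p z.2 ≤ 1 / 3 at h2
    have hK0 : 0 ≤ K := mul_nonneg (mul_nonneg (hp0 _) (hp0 _)) (by positivity)
    have hK2 : K ≤ 2 := by linarith
    calc K * G z ≤ K * (M + max (G z - M) 0) := by
          gcongr
          linarith [le_max_left (G z - M) 0]
      _ = M * K + K * max (G z - M) 0 := by ring
      _ ≤ M * (3 * (1 - r) * (p z.1 + p z.2)) + 2 * max (G z - M) 0 := by gcongr
      _ = _ := by ring
  have hle : 2 - 2 * A ^ 2 ≤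
      M * (3 * (1 - r)) * (2 * π + 2 * π) + 2 * ∫ z, max (G z - M) 0 ∂(μ.prod μ) := by
    rw [← hvar]
    refine (integral_mono_of_nonneg (Filter.Eventually.of_forall fun z =>
      mul_nonneg (mul_nonneg (hp0 _) (hp0 _)) (by positivity))
      ((hsum.const_mul _).add (hmax.const_mul 2))
      (Filter.Eventually.of_forall hbound)).trans_eq ?_
    simp only [Pi.add_apply]
    rw [integral_add (hsum.const_mul _) (hmax.const_mul 2), integral_const_mul,
      integral_const_mul, integral_add hfst hsnd, integral_fun_fst, integral_fun_snd, hp1, hμuniv]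
    simp
  have hA0 : 0 ≤ A := norm_nonneg _
  have hA1 : A ≤ 1 := by
    refine (norm_integral_le_integral_norm _).trans_eq ?_
    rw [← hp1]
    refine integral_congr_ae (Filter.Eventually.of_forall fun α => ?_)
    simp only [norm_smul, hcirc, mul_one, Real.norm_of_nonneg (hp0 α)]
  have hsmall : M * (6 * π * (1 - r)) ≤ ε / 2 := by
    have h1 : 1 - r ≤ η := by linarith
    calc M * (6 * π * (1 - r)) ≤ (M + 1) * (6 * π * η) := by
          gcongr
          linarith
      _ = ε / 2 := by rw [hη]; field_simp
  rw [abs_sub_comm, abs_of_nonneg (by linarith)]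
  nlinarith
end
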